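/- Let G be a finitely generated group with finite generating set K acting continuously and expansively (constant e) on a compact metric space X of positive topological dimension (there exists a connected subset C with more than one point). Suppose the uniform expansiveness property holds with constant N for δ = e/2: any two points at distance ≥ e/2 are separated to distance > e by some g ∈ K_N. Then for every n ≥ 1 there exists an (nN, e/2)-separated set E_n ⊂ X with |E_n| ≥ 2ⁿ, where a set E is (m, ε)-separated if for every pair of distinct points x, y ∈ E there is g ∈ K_m with d(g·x, g·y) > ε. -/

import Mathlib

/-- Points reachable from `a` in `k` steps of the relation `r`. -/
def reachSet {X : Type*} (r : X → X → Prop) (a : X) : ℕ → Set X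
  | 0 => {a}
  | k + 1 => {y | ∃ x ∈ reachSet r a k, r x y}

theorem reachSet_mono {X : Type*} (r : X → X → Prop) (hr : ∀ x, r x x) (a : X) :
    Monotone (reachSet r a) :=
  monotone_nat_of_le_succ fun _ x hx => ⟨x, hx, hr x⟩

theorem reachSet_halve {X : Type*} (r s : X → X → Prop)
    (h : ∀ x y z, r x y → r y z → s x z) (a : X) (k : ℕ) :
    reachSet r a (2 * k) ⊆ reachSet s a k := by
  induction k with
  | zero => exact subset_rfl
  | succ k ih =>
    rintro y ⟨x, ⟨w, hw, hwx⟩, hxy⟩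
    exact ⟨w, ih hw, h _ _ _ hwx hxy⟩

/-- If the reachable sets stop growing they are constant. -/
theorem reachSet_stable {X : Type*} (r : X → X → Prop) (a : X) (i : ℕ)
    (h : reachSet r a (i + 1) ⊆ reachSet r a i) (j : ℕ) :
    reachSet r a (i + j) ⊆ reachSet r a i := by
  induction j with
  | zero => exact subset_rfl
  | succ j ih =>
    rintro y ⟨x, hx, hxy⟩
    exact h ⟨x, ih hx, hxy⟩

theorem exists_separated {X : Type*} (r : X → X → Prop) (hr : ∀ x, r x x)
    (hs : ∀ x y, r x y → r y x) (a b : X) (m M : ℕ) (hm : b ∈ reachSet r a m)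
    (hM : b ∉ reachSet r a (2 * M)) :
    ∃ E : Finset X, M ≤ E.card ∧ ∀ x ∈ E, ∀ y ∈ E, x ≠ y → ¬ r x y := by
  classical
  have mono := reachSet_mono r hr a
  have key : ∀ i, i < M → ∃ z, z ∈ reachSet r a (2 * i + 1) ∧ z ∉ reachSet r a (2 * i) := by
    intro i hi
    by_contra hcon
    push Not at hcon
    have h1 := reachSet_stable r a (2 * i) hcon m
    exact hM (mono (by omega) (h1 (mono (by omega) hm)))
  haveI : Nonempty X := ⟨a⟩
  choose! z hz1 hz2 using key
  have sep : ∀ i j, i < j → j < M → ¬ r (z i) (z j) := by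
    intro i j hij hj hrel
    have : z j ∈ reachSet r a (2 * i + 1 + 1) := ⟨z i, hz1 i (by omega), hrel⟩
    exact hz2 j hj (mono (by omega) this)
  have sep' : ∀ i j, i < M → j < M → i ≠ j → ¬ r (z i) (z j) := by
    intro i j hi hj hij hrel
    rcases lt_or_gt_of_ne hij with h | h
    · exact sep i j h hj hrel
    · exact sep j i h hi (hs _ _ hrel)
  refine ⟨(Finset.range M).image z, ?_, ?_⟩
  · rw [Finset.card_image_of_injOn]
    · simp
    · intro i hi j hj hij
      by_contra hne
      refine sep' i j (by simpa using hi) (by simpa using hj) hne ?_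
      rw [hij]; exact hr _
  · intro x hx y hy hxy
    obtain ⟨i, hi, rfl⟩ := Finset.mem_image.1 hx
    obtain ⟨j, hj, rfl⟩ := Finset.mem_image.1 hy
    exact sep' i j (by simpa using hi) (by simpa using hj) (fun h => hxy (by rw [h]))

theorem exists_reach {X : Type*} [TopologicalSpace X] (r : X → X → Prop)
    (hs : ∀ x y, r x y → r y x) (hn : ∀ x, ∀ᶠ y in nhds x, r x y)
    (C : Set X) (hC : IsPreconnected C) (a b : X) (ha : a ∈ C) (hb : b ∈ C) :
    ∃ m, b ∈ reachSet r a m := by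
  have hclopen : IsClopen {y | ∃ m, y ∈ reachSet r a m} := by
    constructor
    · rw [← isOpen_compl_iff, isOpen_iff_mem_nhds]
      intro x hx
      filter_upwards [hn x] with y hy
      rintro ⟨m, hm⟩
      exact hx ⟨m + 1, y, hm, hs _ _ hy⟩
    · rw [isOpen_iff_mem_nhds]
      rintro x ⟨m, hm⟩
      filter_upwards [hn x] with y hy
      exact ⟨m + 1, x, hm, hy⟩
  exact hC.subset_isClopen hclopen ⟨a, ha, 0, rfl⟩ hb

theorem finite_words {G : Type*} (K : Finset G) (m : ℕ) :
    {l : List G | l.length ≤ m ∧ ∀ a ∈ l, a ∈ K}.Finite := by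
  refine ((List.finite_length_le K m).image (List.map Subtype.val)).subset ?_
  rintro l ⟨hl, hK⟩
  refine ⟨l.attach.map fun a => ⟨a.1, hK _ a.2⟩, by simpa using hl, ?_⟩
  simp

/-- Construction of exponentially large separated sets: for an
expansive action (constant e) of a finitely generated group on a compact
metric space containing a nondegenerate connected set, given the uniform
expansiveness constant N for δ = e/2, for every n ≥ 1 there is an
(nN, e/2)-separated set with at least 2ⁿ elements. -/
theorem stmt_8 {G X : Type*} [Group G] [MetricSpace X] [CompactSpace X]
    (K : Finset G) (hK1 : (1 : G) ∈ K) (hKsymm : ∀ g ∈ K, g⁻¹ ∈ K)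
    (hKgen : Subgroup.closure (K : Set G) = ⊤)
    (Φ : G → X → X)
    (hΦ1 : ∀ x, Φ 1 x = x) (hΦm : ∀ g h x, Φ (g * h) x = Φ g (Φ h x))
    (hΦc : ∀ g, Continuous (Φ g))
    (e : ℝ) (he : 0 < e)
    (hexp : ∀ x y : X, x ≠ y → ∃ g : G, e < dist (Φ g x) (Φ g y))
    (C : Set X) (hC : IsConnected C) (hCnd : ∃ a ∈ C, ∃ b ∈ C, a ≠ b)
    (N : ℕ)
    (huexp : ∀ x y : X, e / 2 ≤ dist x y →
      ∃ g : G, (∃ l : List G, l.length ≤ N ∧ (∀ a ∈ l, a ∈ K) ∧ l.prod = g) ∧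
        e < dist (Φ g x) (Φ g y)) :
    ∀ n : ℕ, 1 ≤ n → ∃ E : Finset X, 2 ^ n ≤ E.card ∧
      ∀ x ∈ E, ∀ y ∈ E, x ≠ y →
        ∃ g : G, (∃ l : List G, l.length ≤ n * N ∧ (∀ a ∈ l, a ∈ K) ∧ l.prod = g) ∧
          e / 2 < dist (Φ g x) (Φ g y) := by
  classical
  obtain ⟨a, ha, b, hb, hab⟩ := hCnd
  obtain ⟨g₀, hg₀⟩ := hexp a b hab
  let R : ℕ → X → X → Prop := fun n x y => ∀ l : List G, l.length ≤ n * N →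
    (∀ a ∈ l, a ∈ K) → dist (Φ l.prod x) (Φ l.prod y) ≤ e / 2
  have hRr : ∀ n x, R n x x := by
    intro n x l _ _
    rw [dist_self]; linarith
  have hRs : ∀ n x y, R n x y → R n y x := by
    intro n x y h l h1 h2
    rw [dist_comm]; exact h l h1 h2
  have hRm : ∀ n x y z, R (n + 1) x y → R (n + 1) y z → R n x z := by
    intro n x y z hxy hyz l hl hlK
    by_contra hcon
    obtain ⟨g, ⟨l', hl', hlK', rfl⟩, hg⟩ := huexp _ _ (not_le.1 hcon).le
    have hlen : (l' ++ l).length ≤ (n + 1) * N := by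
      rw [List.length_append, add_mul, one_mul]; omega
    have hmem : ∀ a ∈ l' ++ l, a ∈ K := by
      intro a ha
      rcases List.mem_append.1 ha with h | h
      · exact hlK' a h
      · exact hlK a h
    have h1 := hxy _ hlen hmem
    have h2 := hyz _ hlen hmem
    rw [← hΦm, ← hΦm, ← List.prod_append] at hg
    have h3 := dist_triangle (Φ (l' ++ l).prod x) (Φ (l' ++ l).prod y) (Φ (l' ++ l).prod z)
    linarith
  have hRn : ∀ n x, ∀ᶠ y in nhds x, R n x y := by
    intro n x
    have := (Filter.eventually_all_finite (l := nhds x) (finite_words K (n * N))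
      (p := fun l y => dist (Φ l.prod x) (Φ l.prod y) ≤ e / 2)).2 (by
        intro l _
        have h := (hΦc l.prod).tendsto x (Metric.ball_mem_nhds _ (half_pos he))
        filter_upwards [h] with y hy
        rw [dist_comm]
        exact (Metric.mem_ball.1 hy).le)
    filter_upwards [this] with y hy l h1 h2
    exact hy l ⟨h1, h2⟩
  have hfar : ∀ n y, y ∈ reachSet (R n) (Φ g₀ a) (2 * 2 ^ n) → dist (Φ g₀ a) y ≤ e := by
    intro n
    induction n with
    | zero =>
      rintro y ⟨x, ⟨w, hw, hwx⟩, hxy⟩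
      obtain rfl : w = Φ g₀ a := hw
      have h1 := hwx [] (by simp) (by simp)
      have h2 := hxy [] (by simp) (by simp)
      simp only [List.prod_nil, hΦ1] at h1 h2
      have h3 := dist_triangle (Φ g₀ a) x y
      linarith
    | succ n ih =>
      intro y hy
      apply ih
      have := reachSet_halve (R (n + 1)) (R n) (hRm n) (Φ g₀ a) (2 ^ (n + 1)) hy
      rwa [pow_succ, mul_comm] at this
  intro n _
  obtain ⟨m, hm⟩ := exists_reach (R n) (hRs n) (hRn n) (Φ g₀ '' C)
    (hC.isPreconnected.image _ (hΦc g₀).continuousOn) (Φ g₀ a) (Φ g₀ b)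
    ⟨a, ha, rfl⟩ ⟨b, hb, rfl⟩
  obtain ⟨E, hE, hsep⟩ := exists_separated (R n) (hRr n) (hRs n) _ _ m (2 ^ n) hm
    (fun h => absurd (hfar n _ h) (not_le.2 hg₀))
  refine ⟨E, hE, fun x hx y hy hxy => ?_⟩
  have h := hsep x hx y hy hxy
  simp only [R] at h
  push Not at h
  obtain ⟨l, h1, h2, h3⟩ := h
  exact ⟨l.prod, ⟨l, h1, h2, rfl⟩, h3⟩
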